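/- Let d and k be positive integers and let φ : {1,…,k} → ℝ^d be vectors with ‖φ_i‖₂ ≤ 1 for all i. For 0 ≤ j ≤ k define Λ_j = I + Σ_{i=1}^{j} φ_i φ_iᵀ. Then Σ_{i=1}^{k} φ_iᵀ (Λ_{i-1})⁻¹ φ_i ≤ 2 d · log( k/d + 1 ). -/

import Mathlib

open Matrix BigOperators

/-- The regularized Gram matrix `Λ_j = I + ∑_{i=1}^{j} φ_i φ_iᵀ`. -/
noncomputable def gramMat (d k : ℕ) (φ : Fin k → Fin d → ℝ) (j : ℕ) :
    Matrix (Fin d) (Fin d) ℝ :=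
  1 + ∑ i : Fin k, if (i : ℕ) < j then vecMulVec (φ i) (φ i) else 0

theorem gram_succ (d k : ℕ) (φ : Fin k → Fin d → ℝ) (i : Fin k) :
    gramMat d k φ ((i : ℕ) + 1) = gramMat d k φ i + vecMulVec (φ i) (φ i) := by
  unfold gramMat
  rw [add_assoc]
  congr 1
  have h : vecMulVec (φ i) (φ i) = ∑ l : Fin k, if l = i then vecMulVec (φ l) (φ l) else 0 := by
    simp
  rw [h, ← Finset.sum_add_distrib]
  refine Finset.sum_congr rfl fun l _ => ?_
  rcases lt_trichotomy (l : ℕ) (i : ℕ) with h | h | h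
  · have : l ≠ i := fun e => by simp [e] at h
    simp [h, this, Nat.lt_succ_of_lt h]
  · have : l = i := Fin.ext h
    simp [this]
  · have h1 : l ≠ i := fun e => by simp [e] at h
    have h2 : ¬ ((l : ℕ) < i + 1) := by omega
    have h3 : ¬ ((l : ℕ) < i) := by omega
    simp [h1, h2, h3]

theorem gram_psd (d k : ℕ) (φ : Fin k → Fin d → ℝ) (j : ℕ) :
    (∑ i : Fin k, if (i : ℕ) < j then vecMulVec (φ i) (φ i) else 0).PosSemidef := by
  refine Matrix.posSemidef_sum _ fun i _ => ?_
  split_ifs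
  · simpa using posSemidef_vecMulVec_self_star (φ i)
  · exact Matrix.PosSemidef.zero

theorem gram_pd (d k : ℕ) (φ : Fin k → Fin d → ℝ) (j : ℕ) : (gramMat d k φ j).PosDef :=
  Matrix.PosDef.one.add_posSemidef (gram_psd d k φ j)

theorem gram_det (d k : ℕ) (φ : Fin k → Fin d → ℝ) (i : Fin k) :
    (gramMat d k φ ((i : ℕ) + 1)).det = (gramMat d k φ i).det *
      (1 + φ i ⬝ᵥ (gramMat d k φ (i : ℕ))⁻¹.mulVec (φ i)) := by
  have hu : IsUnit (gramMat d k φ i).det := (gram_pd d k φ i).det_pos.ne'.isUnit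
  rw [gram_succ, vecMulVec_eq Unit, det_add_replicateCol_mul_replicateRow hu]
  congr 1
  rw [det_unique]
  simp [Matrix.mul_assoc, Matrix.add_apply, Matrix.mul_apply, dotProduct, mulVec]

theorem gram_bd (d k : ℕ) (φ : Fin k → Fin d → ℝ) (j : ℕ) (v : Fin d → ℝ) (hv : v ⬝ᵥ v ≤ 1) :
    0 ≤ v ⬝ᵥ (gramMat d k φ j)⁻¹.mulVec v ∧ v ⬝ᵥ (gramMat d k φ j)⁻¹.mulVec v ≤ 1 := by
  have hu : IsUnit (gramMat d k φ j).det := (gram_pd d k φ j).det_pos.ne'.isUnit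
  set w := (gramMat d k φ j)⁻¹.mulVec v with hw
  have h1 : (gramMat d k φ j).mulVec w = v := by
    rw [hw, mulVec_mulVec, mul_nonsing_inv _ hu, one_mulVec]
  have h2 : w ⬝ᵥ w ≤ v ⬝ᵥ w := by
    have h3 := (gram_psd d k φ j).dotProduct_mulVec_nonneg w
    rw [dotProduct_comm v w]
    conv_rhs => rw [← h1]
    unfold gramMat
    rw [add_mulVec, one_mulVec, dotProduct_add]
    simpa using h3
  have h4 : 0 ≤ w ⬝ᵥ w := Finset.sum_nonneg fun _ _ => mul_self_nonneg _
  have h5 : 0 ≤ (v - w) ⬝ᵥ (v - w) := Finset.sum_nonneg fun _ _ => mul_self_nonneg _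
  rw [sub_dotProduct, dotProduct_sub, dotProduct_sub, dotProduct_comm w v] at h5
  constructor <;> linarith

theorem log_det_bd (d : ℕ) (A : Matrix (Fin d) (Fin d) ℝ) (hA : A.PosDef) (m : ℝ) (hm : 0 < m)
    (ht : A.trace ≤ d * m) : Real.log A.det ≤ d * Real.log m := by
  have hp := hA.eigenvalues_pos
  have hdet := hA.isHermitian.det_eq_prod_eigenvalues
  have htr := hA.isHermitian.trace_eq_sum_eigenvalues
  simp only [RCLike.ofReal_real_eq_id, id] at hdet htr
  rw [hdet, Real.log_prod fun i _ => (hp i).ne']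
  have h : ∀ i ∈ Finset.univ, Real.log (hA.isHermitian.eigenvalues i) ≤
      hA.isHermitian.eigenvalues i / m + (Real.log m - 1) := fun i _ => by
    have := Real.log_le_sub_one_of_pos (div_pos (hp i) hm)
    rw [Real.log_div (hp i).ne' hm.ne'] at this
    linarith
  refine (Finset.sum_le_sum h).trans ?_
  rw [Finset.sum_add_distrib, ← Finset.sum_div, ← htr]
  have : A.trace / m ≤ d := (div_le_iff₀ hm).2 ht
  simp only [Finset.sum_const, Finset.card_univ, Fintype.card_fin, nsmul_eq_mul]
  linarith

/-- Full elliptical potential lemma (Lemma 4 of the paper):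
`∑_{i=1}^{k} φ_iᵀ (Λ_{i-1})⁻¹ φ_i ≤ 2 d log(k/d + 1)`. -/
theorem stmt_2 (d k : ℕ) (hd : 0 < d) (hk : 0 < k)
    (φ : Fin k → Fin d → ℝ)
    (hφ : ∀ i : Fin k, Real.sqrt (∑ j, (φ i j) ^ 2) ≤ 1) :
    ∑ i : Fin k, φ i ⬝ᵥ (gramMat d k φ (i : ℕ))⁻¹.mulVec (φ i)
      ≤ 2 * d * Real.log ((k : ℝ) / d + 1) := by
  have hv : ∀ i, φ i ⬝ᵥ φ i ≤ 1 := fun i => by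
    have := hφ i
    rw [Real.sqrt_le_iff] at this
    simpa [dotProduct, sq] using this.2
  have hd' : (0 : ℝ) < d := by exact_mod_cast hd
  have step : ∀ i : Fin k, φ i ⬝ᵥ (gramMat d k φ (i : ℕ))⁻¹.mulVec (φ i) ≤
      2 * (Real.log (gramMat d k φ ((i : ℕ) + 1)).det - Real.log (gramMat d k φ i).det) := by
    intro i
    obtain ⟨h0, h1⟩ := gram_bd d k φ i (φ i) (hv i)
    rw [gram_det, Real.log_mul (gram_pd d k φ i).det_pos.ne' (by linarith)]
    set x := φ i ⬝ᵥ (gramMat d k φ (i : ℕ))⁻¹.mulVec (φ i)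
    have h2 := Real.le_log_one_add_of_nonneg h0
    have h3 : x / 2 ≤ 2 * x / (x + 2) := by
      rw [div_le_div_iff₀ (by norm_num) (by linarith)]
      nlinarith
    linarith
  refine (Finset.sum_le_sum fun i _ => step i).trans ?_
  rw [← Finset.mul_sum, Fin.sum_univ_eq_sum_range (fun n =>
    Real.log (gramMat d k φ (n + 1)).det - Real.log (gramMat d k φ n).det) k,
    Finset.sum_range_sub (fun n => Real.log (gramMat d k φ n).det)]
  have h0 : gramMat d k φ 0 = 1 := by simp [gramMat]
  have ht : (gramMat d k φ k).trace ≤ d * ((k : ℝ) / d + 1) := by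
    have : (d : ℝ) * ((k : ℝ) / d + 1) = d + k := by field_simp; ring
    rw [this]
    simp only [gramMat, Fin.is_lt, if_true, trace_add, trace_one, trace_sum, trace_vecMulVec,
      Fintype.card_fin]
    have := Finset.sum_le_sum fun i (_ : i ∈ Finset.univ) => hv i
    simp only [Finset.sum_const, Finset.card_univ, Fintype.card_fin, nsmul_eq_mul, mul_one] at this
    linarith
  have := log_det_bd d _ (gram_pd d k φ k) _ (by positivity) ht
  rw [h0, det_one, Real.log_one]
  linarith
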